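/- Let i, j be integers with i ≥ 1 and 0 ≤ j ≤ i, let G be a graph in the family F_{i,j}, and set ε = (5−i)/7 if i ≤ 5 and ε = 0 if i ≥ 5. Then for every edge e of G, φ(G − e) ≤ (2|E(G)| − |V(G)| + 2)/7 + ε − 1. -/

import Mathlib

open SimpleGraph

/-- The minimum size of a feedback vertex set of `G`. -/
noncomputable def phi {V : Type} (G : SimpleGraph V) : ℕ :=
  sInf {n : ℕ | ∃ S : Finset V, S.card = n ∧ (G.induce ((S : Set V)ᶜ)).IsAcyclic}

/-- The graph obtained from `H` by subdividing the edge `uv` once: delete the edge `uv`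
and add a new vertex (`none`) adjacent exactly to `u` and `v`. -/
def subdivideEdge {V : Type} (H : SimpleGraph V) (u v : V) : SimpleGraph (Option V) :=
  SimpleGraph.fromRel (fun x y =>
    (∃ p q : V, x = some p ∧ y = some q ∧ H.Adj p q ∧ s(p, q) ≠ s(u, v)) ∨
    (x = none ∧ (y = some u ∨ y = some v)))

/-- `a` has degree exactly two in `H`. -/
def HasDegreeTwo {V : Type} (H : SimpleGraph V) (a : V) : Prop :=
  ∃ x y : V, x ≠ y ∧ H.Adj a x ∧ H.Adj a y ∧ ∀ z : V, H.Adj a z → z = x ∨ z = y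

/-- The operation `∘` applied with two distinct edges `u₁v₁`, `u₂v₂` and a degree-two vertex `a`:
subdivide both edges (new vertices `inr 0`, `inr 1`), then add a new vertex `inr 2` adjacent to
`a` and the two subdivision vertices. -/
def circOpTwo {V : Type} (H : SimpleGraph V) (u₁ v₁ u₂ v₂ a : V) : SimpleGraph (V ⊕ Fin 3) :=
  SimpleGraph.fromRel (fun x y =>
    (∃ p q : V, x = Sum.inl p ∧ y = Sum.inl q ∧ H.Adj p q ∧
      s(p, q) ≠ s(u₁, v₁) ∧ s(p, q) ≠ s(u₂, v₂)) ∨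
    (x = Sum.inr 0 ∧ (y = Sum.inl u₁ ∨ y = Sum.inl v₁)) ∨
    (x = Sum.inr 1 ∧ (y = Sum.inl u₂ ∨ y = Sum.inl v₂)) ∨
    (x = Sum.inr 2 ∧ (y = Sum.inl a ∨ y = Sum.inr 0 ∨ y = Sum.inr 1)))

/-- The operation `∘` applied with `e₁ = e₂ = uv` and a degree-two vertex `a`: subdivide the
edge `uv` twice (replacing it by the path `u, inr 0, inr 1, v`), then add a new vertex `inr 2`
adjacent to `a` and the two subdivision vertices. -/
def circOpOne {V : Type} (H : SimpleGraph V) (u v a : V) : SimpleGraph (V ⊕ Fin 3) :=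
  SimpleGraph.fromRel (fun x y =>
    (∃ p q : V, x = Sum.inl p ∧ y = Sum.inl q ∧ H.Adj p q ∧ s(p, q) ≠ s(u, v)) ∨
    (x = Sum.inr 0 ∧ (y = Sum.inl u ∨ y = Sum.inr 1)) ∨
    (x = Sum.inr 1 ∧ y = Sum.inl v) ∨
    (x = Sum.inr 2 ∧ (y = Sum.inl a ∨ y = Sum.inr 0 ∨ y = Sum.inr 1)))

/-- `G` is obtained from `H` by one application of the operation `∘` at the degree-two
vertex `a`, using two (not necessarily distinct) edges of `H`. -/
def IsCircOp {V : Type} (H : SimpleGraph V) (a : V) (G : SimpleGraph (V ⊕ Fin 3)) : Prop :=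
  (∃ u₁ v₁ u₂ v₂ : V, H.Adj u₁ v₁ ∧ H.Adj u₂ v₂ ∧ s(u₁, v₁) ≠ s(u₂, v₂) ∧
      G = circOpTwo H u₁ v₁ u₂ v₂ a) ∨
  (∃ u v : V, H.Adj u v ∧ G = circOpOne H u v a)

/-- Membership (up to isomorphism) in the family `F_{i,j}`. -/
inductive IsInF : ∀ (i j : ℕ) {V : Type}, SimpleGraph V → Prop
  | cycle (i : ℕ) (hi : 3 ≤ i) : IsInF i 0 (SimpleGraph.cycleGraph i)
  | k4 : IsInF 1 1 (⊤ : SimpleGraph (Fin 4))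
  | subdiv {i j : ℕ} {V : Type} {H : SimpleGraph V} {u v : V}
      (huv : H.Adj u v) (hH : IsInF i j H) : IsInF (i + 1) j (subdivideEdge H u v)
  | op {i j : ℕ} {V : Type} {H : SimpleGraph V} {a : V} {G : SimpleGraph (V ⊕ Fin 3)}
      (ha : HasDegreeTwo H a) (hG : IsCircOp H a G) (hH : IsInF i j H) : IsInF i (j + 1) G
  | iso {i j : ℕ} {V W : Type} {H : SimpleGraph V} {G : SimpleGraph W}
      (e : Nonempty (G ≃g H)) (hH : IsInF i j H) : IsInF i j G

/-- `G` is a graph obtained from `H` by repeatedly (possibly zero times) subdividing edges. -/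
inductive IsSubdivisionOf : ∀ {V : Type}, SimpleGraph V → ∀ {W : Type}, SimpleGraph W → Prop
  | refl {V : Type} (G : SimpleGraph V) : IsSubdivisionOf G G
  | step {V W : Type} {H : SimpleGraph V} {G : SimpleGraph W} {u v : W}
      (huv : G.Adj u v) (h : IsSubdivisionOf H G) : IsSubdivisionOf H (subdivideEdge G u v)

/-- `G` contains an induced subdivision of `H`: some induced subgraph of `G` is isomorphic
to a graph obtained from `H` by repeatedly subdividing edges. -/
def ContainsInducedSubdivision {V W : Type} (G : SimpleGraph V) (H : SimpleGraph W) : Prop :=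
  ∃ (s : Set V) (U : Type) (K : SimpleGraph U),
    IsSubdivisionOf H K ∧ Nonempty (G.induce s ≃g K)

/-- The family `𝓕`: members of `F_{4,2} ∪ F_{4,3}` of girth at least five, together with
members `H` of `F_{3,2} ∪ F_{3,3}` having an edge `e` such that `H − e` has girth at least
five. -/
def InFamilyF {W : Type} (H : SimpleGraph W) : Prop :=
  ((IsInF 4 2 H ∨ IsInF 4 3 H) ∧ 5 ≤ H.girth) ∨
  ((IsInF 3 2 H ∨ IsInF 3 3 H) ∧ ∃ e ∈ H.edgeSet, 5 ≤ (H.deleteEdges {e}).girth)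

/-- `G` contains two vertex-disjoint cycles, each of length less than five. -/
def HasTwoDisjointShortCycles {V : Type} (G : SimpleGraph V) : Prop :=
  ∃ (u v : V) (c₁ : G.Walk u u) (c₂ : G.Walk v v), c₁.IsCycle ∧ c₂.IsCycle ∧
    c₁.length < 5 ∧ c₂.length < 5 ∧ ∀ x : V, x ∈ c₁.support → x ∉ c₂.support


def Good {V : Type} (H : SimpleGraph V) (p q : V) (n : ℕ) : Prop :=
  ∃ (S : Finset V) (f : V → ℚ), S.card ≤ n ∧
    (∀ x y, x ∉ S → y ∉ S → H.Adj x y → s(x, y) ≠ s(p, q) → f x ≠ f y) ∧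
    (∀ x y z, x ∉ S → y ∉ S → z ∉ S → H.Adj x y → H.Adj x z → s(x, y) ≠ s(p, q) →
      s(x, z) ≠ s(p, q) → f y < f x → f z < f x → y = z)

def AllGood {V : Type} (n : ℕ) (H : SimpleGraph V) : Prop :=
  ∀ p q, H.Adj p q → Good H p q n

theorem acyclic_of_rank {V : Type} (G : SimpleGraph V) (f : V → ℚ)
    (h1 : ∀ x y, G.Adj x y → f x ≠ f y)
    (h2 : ∀ x y z, G.Adj x y → G.Adj x z → f y < f x → f z < f x → y = z) : G.IsAcyclic := by
  classical
  intro v c hc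
  obtain ⟨x, hx, hmax⟩ := c.support.toFinset.exists_max_image f ⟨v, by simp⟩
  have hx' : x ∈ c.support := by simpa using hx
  have hc' := hc.rotate hx'
  set d := c.rotate x hx' with hd
  have hsup : ∀ y ∈ d.support, f y ≤ f x := by
    intro y hy
    apply hmax
    rw [List.mem_toFinset]
    exact (c.mem_support_rotate_iff x hx').1 hy
  have hnil := hc'.not_nil
  have a1 : G.Adj x d.snd := d.adj_snd hnil
  have a2 : G.Adj d.penultimate x := d.adj_penultimate hnil
  refine hc'.snd_ne_penultimate (h2 x _ _ a1 a2.symm ?_ ?_)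
  · exact lt_of_le_of_ne (hsup _ (d.getVert_mem_support _)) (h1 _ _ a1).symm
  · exact lt_of_le_of_ne (hsup _ (d.getVert_mem_support _)) (h1 _ _ a2)

theorem phi_le_of_good {V : Type} {H : SimpleGraph V} {p q : V} {n : ℕ} (h : Good H p q n) :
    phi (H.deleteEdges {s(p, q)}) ≤ n := by
  obtain ⟨S, f, hS, h1, h2⟩ := h
  refine le_trans (Nat.sInf_le ⟨S, rfl, ?_⟩) hS
  apply acyclic_of_rank _ (fun x => f x.1)
  · rintro ⟨x, hx⟩ ⟨y, hy⟩ hxy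
    simp at hx hy
    simp [SimpleGraph.deleteEdges_adj] at hxy
    apply h1 x y hx hy hxy.1
    simpa using hxy.2
  · rintro ⟨x, hx⟩ ⟨y, hy⟩ ⟨z, hz⟩ hxy hxz hfy hfz
    simp at hx hy hz
    simp [SimpleGraph.deleteEdges_adj] at hxy hxz
    exact Subtype.ext (h2 x y z hx hy hz hxy.1 hxz.1 (by simpa using hxy.2) (by simpa using hxz.2) hfy hfz)

theorem AllGood.iso {V W : Type} {H : SimpleGraph V} {G : SimpleGraph W} (e : G ≃g H) {n : ℕ}
    (h : AllGood n H) : AllGood n G := by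
  intro p q hpq
  obtain ⟨S, f, hS, h1, h2⟩ := h (e p) (e q) (e.map_adj_iff.2 hpq)
  have key : ∀ x y, s(x, y) ≠ s(p, q) → s(e x, e y) ≠ s(e p, e q) := by
    intro x y hne
    simpa using hne
  refine ⟨S.map e.symm.toEquiv.toEmbedding, fun x => f (e x), by simpa using hS, ?_, ?_⟩
  · intro x y hx hy hxy hne
    refine h1 _ _ ?_ ?_ (e.map_adj_iff.2 hxy) (key _ _ hne)
    · contrapose! hx; simp only [Finset.mem_map_equiv]; exact hx
    · contrapose! hy; simp only [Finset.mem_map_equiv]; exact hy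
  · intro x y z hx hy hz hxy hxz hne hne' hf hf'
    refine e.injective (h2 _ _ _ ?_ ?_ ?_ (e.map_adj_iff.2 hxy) (e.map_adj_iff.2 hxz) (key _ _ hne)
      (key _ _ hne') hf hf')
    · contrapose! hx; simp only [Finset.mem_map_equiv]; exact hx
    · contrapose! hy; simp only [Finset.mem_map_equiv]; exact hy
    · contrapose! hz; simp only [Finset.mem_map_equiv]; exact hz

theorem Good.swap {V : Type} {H : SimpleGraph V} {p q : V} {n : ℕ} (h : Good H p q n) :
    Good H q p n := by
  unfold Good at *
  rwa [Sym2.eq_swap]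

@[simp] theorem sub_some_some {V : Type} {H : SimpleGraph V} {u v p q : V} :
    (subdivideEdge H u v).Adj (some p) (some q) ↔ H.Adj p q ∧ s(p, q) ≠ s(u, v) := by
  simp only [subdivideEdge, SimpleGraph.fromRel_adj]
  constructor
  · rintro ⟨h, (⟨p', q', h1, h2, h3, h4⟩ | h) | (⟨p', q', h1, h2, h3, h4⟩ | h)⟩
    · cases h1; cases h2; exact ⟨h3, h4⟩
    · simp at h
    · cases h1; cases h2; exact ⟨h3.symm, by rwa [Sym2.eq_swap]⟩
    · simp at h
  · rintro ⟨h, h'⟩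
    exact ⟨by simpa using h.ne, Or.inl (Or.inl ⟨p, q, rfl, rfl, h, h'⟩)⟩

@[simp] theorem sub_none_some {V : Type} {H : SimpleGraph V} {u v q : V} :
    (subdivideEdge H u v).Adj none (some q) ↔ q = u ∨ q = v := by
  simp [subdivideEdge, SimpleGraph.fromRel_adj]

@[simp] theorem sub_some_none {V : Type} {H : SimpleGraph V} {u v q : V} :
    (subdivideEdge H u v).Adj (some q) none ↔ q = u ∨ q = v := by
  rw [SimpleGraph.adj_comm]; simp

/-- add a vertex adjacent to `a`, `b`, `c` -/
def addVertex {V : Type} (H : SimpleGraph V) (a b c : V) : SimpleGraph (Option V) :=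
  SimpleGraph.fromRel (fun x y =>
    (∃ p q : V, x = some p ∧ y = some q ∧ H.Adj p q) ∨
    (x = none ∧ (y = some a ∨ y = some b ∨ y = some c)))

@[simp] theorem add_some_some {V : Type} {H : SimpleGraph V} {a b c p q : V} :
    (addVertex H a b c).Adj (some p) (some q) ↔ H.Adj p q := by
  simp only [addVertex, SimpleGraph.fromRel_adj]
  constructor
  · rintro ⟨h, (⟨p', q', h1, h2, h3⟩ | h) | (⟨p', q', h1, h2, h3⟩ | h)⟩
    · cases h1; cases h2; exact h3
    · simp at h
    · cases h1; cases h2; exact h3.symm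
    · simp at h
  · rintro h
    exact ⟨by simpa using h.ne, Or.inl (Or.inl ⟨p, q, rfl, rfl, h⟩)⟩

@[simp] theorem add_none_some {V : Type} {H : SimpleGraph V} {a b c q : V} :
    (addVertex H a b c).Adj none (some q) ↔ q = a ∨ q = b ∨ q = c := by
  simp [addVertex, SimpleGraph.fromRel_adj]

@[simp] theorem add_some_none {V : Type} {H : SimpleGraph V} {a b c q : V} :
    (addVertex H a b c).Adj (some q) none ↔ q = a ∨ q = b ∨ q = c := by
  rw [SimpleGraph.adj_comm]; simp

theorem sub_good_old {V : Type} {H : SimpleGraph V} {u v p q : V} {n : ℕ} (huv : H.Adj u v)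
    (hne : s(p, q) ≠ s(u, v)) (h : Good H p q n) :
    Good (subdivideEdge H u v) (some p) (some q) n := by
  classical
  obtain ⟨S, f, hS, h1, h2⟩ := h
  have huv' := huv.symm
  have hvu := huv.ne
  simp only [ne_eq, Sym2.eq_iff] at h1 h2 hne
  have hr : ∃ r : ℚ, (u ∉ S → v ∉ S → (f u < r ∧ r < f v) ∨ (f v < r ∧ r < f u)) ∧
      (u ∈ S → f v < r) ∧ (v ∈ S → f u < r) := by
    by_cases hu : u ∈ S
    · exact ⟨max (f u) (f v) + 1, by simp [hu], by grind, by grind⟩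
    by_cases hv : v ∈ S
    · exact ⟨max (f u) (f v) + 1, by simp [hv], by grind, by grind⟩
    have := h1 u v hu hv huv (by grind)
    refine ⟨(f u + f v) / 2, fun _ _ => ?_, by simp [hu], by simp [hv]⟩
    rcases lt_or_gt_of_ne this with h | h
    · left; constructor <;> linarith
    · right; constructor <;> linarith
  obtain ⟨r, r1, r2, r3⟩ := hr
  have k1 := fun z => h2 u v z
  have k2 := fun z => h2 v u z
  refine ⟨S.map Function.Embedding.some, fun x => x.elim r f, by simpa using hS, ?_, ?_⟩
  · rintro (_ | x) (_ | y) <;> simp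
    all_goals grind
  · rintro (_ | x) (_ | y) (_ | z) <;> simp
    all_goals first
      | (intros; apply h2 x y z <;> first | assumption | (clear h1 h2; grind))
      | grind

theorem sub_good_new {V : Type} {H : SimpleGraph V} {u v : V} {n : ℕ} (huv : H.Adj u v)
    (h : Good H u v n) :
    Good (subdivideEdge H u v) none (some u) n := by
  classical
  obtain ⟨S, f, hS, h1, h2⟩ := h
  have huv' := huv.symm
  have hvu := huv.ne
  simp only [ne_eq, Sym2.eq_iff] at h1 h2
  refine ⟨S.map Function.Embedding.some, fun x => x.elim (f v + 1) f, by simpa using hS,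
    ?_, ?_⟩
  · rintro (_ | x) (_ | y) <;> simp
    all_goals grind
  · rintro (_ | x) (_ | y) (_ | z) <;> simp
    all_goals first
      | (intros; apply h2 x y z <;> first | assumption | (clear h1 h2; grind))
      | grind

theorem sub_comm {V : Type} (H : SimpleGraph V) (u v : V) :
    subdivideEdge H u v = subdivideEdge H v u := by
  ext x y
  rcases x with _ | x <;> rcases y with _ | y <;> simp [or_comm, Sym2.eq_swap (a := u)]

theorem AllGood.sub {V : Type} {H : SimpleGraph V} {u v : V} {n : ℕ} (huv : H.Adj u v)
    (h : AllGood n H) : AllGood n (subdivideEdge H u v) := by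
  have hn : ∀ q, (subdivideEdge H u v).Adj none (some q) →
      Good (subdivideEdge H u v) none (some q) n := by
    intro q hq
    rcases sub_none_some.1 hq with rfl | rfl
    · exact sub_good_new huv (h _ _ huv)
    · rw [sub_comm]
      exact sub_good_new huv.symm (h _ _ huv.symm)
  rintro (_ | p) (_ | q) hpq
  · simp at hpq
  · exact hn q hpq
  · exact (hn p hpq.symm).swap
  · have := sub_some_some.1 hpq
    exact sub_good_old huv this.2 (h _ _ this.1)

/-- delete the new vertex -/
theorem add_good_old {V : Type} {H : SimpleGraph V} {a b c p q : V} {n : ℕ}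
    (h : Good H p q n) :
    Good (addVertex H a b c) (some p) (some q) (n + 1) := by
  classical
  obtain ⟨S, f, hS, h1, h2⟩ := h
  simp only [ne_eq, Sym2.eq_iff] at h1 h2
  refine ⟨insert none (S.map Function.Embedding.some), fun x => x.elim 0 f,
    (Finset.card_insert_le _ _).trans (by simpa using hS), ?_, ?_⟩
  · rintro (_ | x) (_ | y) <;> simp
    all_goals grind
  · rintro (_ | x) (_ | y) (_ | z) <;> simp
    all_goals first
      | (intros; apply h2 x y z <;> first | assumption | (clear h1 h2; grind))
      | grind

/-- delete an old neighbour `b` -/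
theorem add_good_new {V : Type} {H : SimpleGraph V} {a b c d : V} {n : ℕ}
    (h : Good H b d n) :
    Good (addVertex H a b c) none (some a) (n + 1) := by
  classical
  obtain ⟨S, f, hS, h1, h2⟩ := h
  simp only [ne_eq, Sym2.eq_iff] at h1 h2
  refine ⟨insert (some b) (S.map Function.Embedding.some), fun x => x.elim (f c + 1) f,
    (Finset.card_insert_le _ _).trans (by simpa using hS), ?_, ?_⟩
  · rintro (_ | x) (_ | y) <;> simp
    all_goals grind
  · rintro (_ | x) (_ | y) (_ | z) <;> simp
    all_goals first
      | (intros; apply h2 x y z <;> first | assumption | (clear h1 h2; grind))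
      | grind

theorem add_perm {V : Type} (H : SimpleGraph V) (a b c : V) :
    addVertex H a b c = addVertex H b c a ∧ addVertex H a b c = addVertex H c b a := by
  constructor <;> ext x y <;> rcases x with _ | x <;> rcases y with _ | y <;> simp <;> tauto

theorem AllGood.add {V : Type} {H : SimpleGraph V} {a b c d d' : V} {n : ℕ} (hb : H.Adj b d)
    (hc : H.Adj c d') (h : AllGood n H) : AllGood (n + 1) (addVertex H a b c) := by
  have hn : ∀ q, (addVertex H a b c).Adj none (some q) →
      Good (addVertex H a b c) none (some q) (n + 1) := by
    intro q hq
    rcases add_none_some.1 hq with rfl | rfl | rfl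
    · exact add_good_new (h _ _ hb)
    · rw [(add_perm H a q c).1]
      exact add_good_new (h _ _ hc)
    · rw [(add_perm H a b q).2]
      exact add_good_new (h _ _ hb)
  rintro (_ | p) (_ | q) hpq
  · simp at hpq
  · exact hn q hpq
  · exact (hn p hpq.symm).swap
  · exact add_good_old (h _ _ (add_some_some.1 hpq))

theorem count_sub {V : Type} [Finite V] {H : SimpleGraph V} {u v : V} (huv : H.Adj u v) :
    H.edgeSet.ncard + 1 ≤ (subdivideEdge H u v).edgeSet.ncard := by
  have hsub : Sym2.map some '' (H.edgeSet \ {s(u, v)}) ∪ {s(none, some u), s(none, some v)} ⊆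
      (subdivideEdge H u v).edgeSet := by
    rintro x (⟨y, hy, rfl⟩ | hx)
    · induction y with | _ p q
      simpa using hy
    · rcases hx with rfl | rfl <;> simp
  have h1 := Set.ncard_le_ncard hsub (Set.toFinite _)
  rw [Set.ncard_union_eq ?_ (Set.toFinite _) (Set.toFinite _),
    Set.ncard_image_of_injective _ (Sym2.map.injective (Option.some_injective _)),
    Set.ncard_pair (by simpa using huv.ne)] at h1
  · have := Set.ncard_diff_singleton_add_one (s := H.edgeSet) (a := s(u, v)) huv (Set.toFinite _)
    omega
  · rw [Set.disjoint_left]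
    rintro x ⟨y, hy, rfl⟩
    induction y with | _ p q
    simp

theorem count_add {V : Type} [Finite V] {H : SimpleGraph V} {a b c : V} (hab : a ≠ b) (hac : a ≠ c)
    (hbc : b ≠ c) : H.edgeSet.ncard + 3 ≤ (addVertex H a b c).edgeSet.ncard := by
  have hsub : Sym2.map some '' H.edgeSet ∪ {s(none, some a), s(none, some b), s(none, some c)} ⊆
      (addVertex H a b c).edgeSet := by
    rintro x (⟨y, hy, rfl⟩ | hx)
    · induction y with | _ p q
      simpa using hy
    · rcases hx with rfl | rfl | rfl <;> simp
  have h1 := Set.ncard_le_ncard hsub (Set.toFinite _)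
  rw [Set.ncard_union_eq ?_ (Set.toFinite _) (Set.toFinite _),
    Set.ncard_image_of_injective _ (Sym2.map.injective (Option.some_injective _)),
    Set.ncard_eq_three.2 ⟨_, _, _, by simpa using hab, by simpa using hac, by simpa using hbc,
      rfl⟩] at h1
  · exact h1
  · rw [Set.disjoint_left]
    rintro x ⟨y, hy, rfl⟩
    induction y with | _ p q
    simp

/-- The invariant. -/
def FInv (i j : ℕ) {V : Type} (H : SimpleGraph V) : Prop :=
  Finite V ∧ 7 * j + i + Nat.card V ≤ 2 * H.edgeSet.ncard ∧ AllGood j H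

theorem FInv.iso {i j : ℕ} {V W : Type} {H : SimpleGraph V} {G : SimpleGraph W} (e : G ≃g H)
    (h : FInv i j H) : FInv i j G := by
  obtain ⟨hf, hc, hg⟩ := h
  refine ⟨Finite.of_equiv _ e.symm.toEquiv, ?_, hg.iso e⟩
  rw [Nat.card_congr e.toEquiv]
  have : G.edgeSet.ncard = H.edgeSet.ncard := Nat.card_congr e.mapEdgeSet
  omega

theorem FInv.sub {i j : ℕ} {V : Type} {H : SimpleGraph V} {u v : V} (huv : H.Adj u v)
    (h : FInv i j H) : FInv (i + 1) j (subdivideEdge H u v) := by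
  obtain ⟨hf, hc, hg⟩ := h
  have := count_sub huv
  refine ⟨inferInstance, ?_, hg.sub huv⟩
  rw [Finite.card_option]
  omega

theorem FInv.add {i j : ℕ} {V : Type} {H : SimpleGraph V} {a b c d d' : V} (hb : H.Adj b d)
    (hc : H.Adj c d') (hab : a ≠ b) (hac : a ≠ c) (hbc : b ≠ c)
    (h : FInv (i + 2) j H) : FInv i (j + 1) (addVertex H a b c) := by
  obtain ⟨hf, hcard, hg⟩ := h
  have := count_add (H := H) hab hac hbc
  refine ⟨inferInstance, ?_, hg.add hb hc⟩
  rw [Finite.card_option]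
  omega

def eqv (V : Type) : V ⊕ Fin 3 ≃ Option (Option (Option V)) where
  toFun x := match x with
    | Sum.inl p => some (some (some p))
    | Sum.inr 0 => some (some none)
    | Sum.inr 1 => some none
    | Sum.inr 2 => none
  invFun x := match x with
    | some (some (some p)) => Sum.inl p
    | some (some none) => Sum.inr 0
    | some none => Sum.inr 1
    | none => Sum.inr 2
  left_inv := by
    rintro (p | k)
    · rfl
    · fin_cases k <;> rfl
  right_inv := by
    rintro (_ | _ | _ | p) <;> rfl

theorem two_iso {V : Type} {H : SimpleGraph V} {u₁ v₁ u₂ v₂ a : V} :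
    Nonempty (circOpTwo H u₁ v₁ u₂ v₂ a ≃g
      addVertex (subdivideEdge (subdivideEdge H u₁ v₁) (some u₂) (some v₂))
        (some (some a)) (some none) none) := by
  refine ⟨⟨eqv V, ?_⟩⟩
  rintro (p | k) (q | l)
  · simp [eqv, circOpTwo, SimpleGraph.fromRel_adj, SimpleGraph.adj_comm H q p]
    have := @SimpleGraph.Adj.ne _ H p q
    grind
  · fin_cases l <;> simp [eqv, circOpTwo, SimpleGraph.fromRel_adj]
  · fin_cases k <;> simp [eqv, circOpTwo, SimpleGraph.fromRel_adj]
  · fin_cases k <;> fin_cases l <;> simp [eqv, circOpTwo, SimpleGraph.fromRel_adj]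

theorem one_iso {V : Type} {H : SimpleGraph V} {u v a : V} (huv : u ≠ v) :
    Nonempty (circOpOne H u v a ≃g
      addVertex (subdivideEdge (subdivideEdge H u v) none (some v))
        (some (some a)) (some none) none) := by
  refine ⟨⟨eqv V, ?_⟩⟩
  rintro (p | k) (q | l)
  · simp [eqv, circOpOne, SimpleGraph.fromRel_adj, SimpleGraph.adj_comm H q p]
    have := @SimpleGraph.Adj.ne _ H p q
    grind
  · fin_cases l <;> simp [eqv, circOpOne, SimpleGraph.fromRel_adj] <;> grind
  · fin_cases k <;> simp [eqv, circOpOne, SimpleGraph.fromRel_adj] <;> grind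
  · fin_cases k <;> fin_cases l <;> simp [eqv, circOpOne, SimpleGraph.fromRel_adj]

theorem FInv.op {i j : ℕ} {V : Type} {H : SimpleGraph V} {a : V} {G : SimpleGraph (V ⊕ Fin 3)}
    (hG : IsCircOp H a G) (h : FInv i j H) : FInv i (j + 1) G := by
  rcases hG with ⟨u₁, v₁, u₂, v₂, h1, h2, hne, rfl⟩ | ⟨u, v, h1, rfl⟩
  · refine FInv.iso two_iso.some ?_
    refine FInv.add (d := some (some u₁)) (d' := some (some u₂)) ?_ ?_ ?_ ?_ ?_ ((h.sub h1).sub ?_)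
    all_goals simp
    exact ⟨h2, by simpa using hne.symm⟩
  · refine FInv.iso (one_iso h1.ne).some ?_
    refine FInv.add (d := none) (d' := some none) ?_ ?_ ?_ ?_ ?_ ((h.sub h1).sub ?_)
    all_goals simp

theorem FInv.k4 : FInv 1 1 (⊤ : SimpleGraph (Fin 4)) := by
  refine ⟨inferInstance, ?_, ?_⟩
  · have : (⊤ : SimpleGraph (Fin 4)).edgeSet.ncard = 6 := by
      rw [Set.ncard_eq_toFinset_card']
      decide
    rw [this]; simp
  · have key : ∀ p q : Fin 4, p ≠ q → ∃ x y z : Fin 4, p ≠ x ∧ q ≠ x ∧ p ≠ y ∧ q ≠ y ∧ x ≠ y ∧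
      ∀ w, w = p ∨ w = q ∨ w = x ∨ w = y := by decide
    intro p q hpq
    obtain ⟨x, y, z, h⟩ := key p q hpq
    refine ⟨{x}, fun w => if w = y then 0 else 1, by simp, ?_, ?_⟩
    · intro s t
      have hs := h.2.2.2.2.2 s
      have ht := h.2.2.2.2.2 t
      simp
      grind
    · intro s t r
      have hs := h.2.2.2.2.2 s
      have ht := h.2.2.2.2.2 t
      have hr := h.2.2.2.2.2 r
      simp
      grind

theorem FInv.cycle (i : ℕ) (hi : 3 ≤ i) : FInv i 0 (SimpleGraph.cycleGraph i) := by
  obtain ⟨n, rfl⟩ : ∃ n, i = n + 1 + 2 := ⟨i - 3, by omega⟩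
  refine ⟨inferInstance, ?_, ?_⟩
  · have h1 := (SimpleGraph.cycleGraph (n + 1 + 2)).sum_degrees_eq_twice_card_edges
    simp only [SimpleGraph.cycleGraph_degree_three_le] at h1
    rw [Set.ncard_eq_toFinset_card', ← SimpleGraph.edgeFinset, ← h1]
    simp
    omega
  · have key : ∀ p q : Fin (n + 1 + 2), q - p = 1 →
        Good (SimpleGraph.cycleGraph (n + 1 + 2)) p q 0 := by
      intro p q hpq
      have hp : p = q - 1 := by rw [← hpq]; abel
      have hstep : ∀ x y : Fin (n + 1 + 2), x - y = 1 → s(x, y) ≠ s(p, q) →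
          (x - q).val = (y - q).val + 1 := by
        intro x y hxy hne
        have e : x - q = (y - q) + 1 := by rw [← hxy]; abel
        rw [e, Fin.val_add_one, if_neg]
        intro hl
        apply hne
        have : y - q = -1 := by rw [hl, eq_neg_iff_add_eq_zero]; exact Fin.last_add_one _
        have hy : y = p := by rw [hp, sub_eq_iff_eq_add.1 this]; abel
        have hx : x = q := by rw [sub_eq_iff_eq_add.1 hxy, hy, hp]; abel
        rw [hx, hy, Sym2.eq_swap]
      refine ⟨∅, fun x => ((x - q).val : ℚ), by simp, ?_, ?_⟩
      · intro x y _ _ hxy hne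
        simp only [ne_eq, Nat.cast_inj]
        rcases SimpleGraph.cycleGraph_adj.1 hxy with h | h
        · have := hstep _ _ h hne; omega
        · have := hstep _ _ h (by rwa [Sym2.eq_swap]); omega
      · intro x y z _ _ _ hxy hxz hne hne' hf hf'
        simp only [Nat.cast_lt] at hf hf'
        rcases SimpleGraph.cycleGraph_adj.1 hxy with h | h
        · rcases SimpleGraph.cycleGraph_adj.1 hxz with h' | h'
          · exact sub_right_injective (h.trans h'.symm)
          · have := hstep _ _ h' (by rwa [Sym2.eq_swap]); omega
        · have := hstep _ _ h (by rwa [Sym2.eq_swap]); omega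
    intro p q hpq
    rcases SimpleGraph.cycleGraph_adj.1 hpq with h | h
    · exact (key q p h).swap
    · exact key p q h

theorem inv_of_isInF {i j : ℕ} {V : Type} {G : SimpleGraph V} (h : IsInF i j G) : FInv i j G := by
  induction h with
  | cycle i hi => exact FInv.cycle i hi
  | k4 => exact FInv.k4
  | subdiv huv _ ih => exact ih.sub huv
  | op _ hG _ ih => exact ih.op hG
  | iso e _ ih => exact ih.iso e.some

/-- Let `i ≥ 1`, `0 ≤ j ≤ i`, `G ∈ F_{i,j}`, and set `ε = (5−i)/7` if `i ≤ 5`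
and `ε = 0` if `i ≥ 5`. Then `φ(G − e) ≤ (2|E(G)| − |V(G)| + 2)/7 + ε − 1` for every edge
`e` of `G`. -/
theorem statement_10 (i j : ℕ) (hi : 1 ≤ i) (hj : j ≤ i) {V : Type} (G : SimpleGraph V)
    (hG : IsInF i j G) (ε : ℝ)
    (hε₁ : i ≤ 5 → ε = (5 - (i : ℝ)) / 7) (hε₂ : 5 ≤ i → ε = 0)
    (e : Sym2 V) (he : e ∈ G.edgeSet) :
    (phi (G.deleteEdges {e}) : ℝ) ≤
      (2 * (G.edgeSet.ncard : ℝ) - (Nat.card V : ℝ) + 2) / 7 + ε - 1 := by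
  obtain ⟨hf, hc, hg⟩ := inv_of_isInF hG
  induction e with | _ p q
  have h1 : (phi (G.deleteEdges {s(p, q)}) : ℝ) ≤ j := by
    exact_mod_cast phi_le_of_good (hg p q he)
  have h2 : 7 * (j : ℝ) + i + Nat.card V ≤ 2 * G.edgeSet.ncard := by exact_mod_cast hc
  rcases le_total i 5 with h | h
  · rw [hε₁ h]; linarith
  · rw [hε₂ h]
    have : (5 : ℝ) ≤ i := by exact_mod_cast h
    linarith
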